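/- Let ν > −1/2 and let a, b be positive reals. If a > b, or a = b and ν > −1/2, then the terms of the series Σ_{k=0}^∞ (−1)^k (b/2)^{2k} Li_{-2k}(e^{-a}) / (k! · Γ(1+ν+k)) satisfy, as k → ∞, the bound (b/2)^{2k} Li_{-2k}(e^{-a}) / (k! · Γ(1+ν+k)) = O( k^{−ν−1/2} (b/a)^{2k} ); in particular the series converges absolutely when a > b. -/

import Mathlib

open Filter Asymptotics

/-- The polylogarithm of negative integer order `-m` evaluated at `e^{-a}`. -/
noncomputable def negOrderPolylog (m : ℕ) (a : ℝ) : ℝ :=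
  ∑' n : ℕ, ((n : ℝ) + 1) ^ m * Real.exp (-a * ((n : ℝ) + 1))

theorem integral_pow_mul_exp_neg_mul_Ioi (m : ℕ) {a : ℝ} (ha : 0 < a) :
    ∫ x in Set.Ioi (0 : ℝ), x ^ m * Real.exp (-a * x) = m.factorial / a ^ (m + 1) := by
  have h := Real.integral_rpow_mul_exp_neg_mul_Ioi (a := (m : ℝ) + 1) (r := a) (by positivity) ha
  rw [Real.Gamma_nat_eq_factorial] at h
  simp only [add_sub_cancel_right, Real.rpow_natCast] at h
  have h2 : (1 / a) ^ ((m : ℝ) + 1) = 1 / a ^ (m + 1) := by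
    rw [← Nat.cast_add_one, Real.rpow_natCast, one_div_pow]
  simp only [neg_mul]
  rw [h, h2]
  ring

theorem negOrderPolylog_nonneg (m : ℕ) (a : ℝ) : 0 ≤ negOrderPolylog m a :=
  tsum_nonneg fun n => by positivity

/-- Comparison of the polylogarithm series with `∫ x ^ m * exp (-a * x)`. -/
theorem negOrderPolylog_le (m : ℕ) {a : ℝ} (ha : 0 < a) :
    negOrderPolylog m a ≤ Real.exp a * (m.factorial / a ^ (m + 1)) := by
  have hcont : Continuous fun x : ℝ => x ^ m * Real.exp (-a * x) := by fun_prop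
  have hval := integral_pow_mul_exp_neg_mul_Ioi m ha
  have hint : MeasureTheory.IntegrableOn (fun x : ℝ => x ^ m * Real.exp (-a * x))
      (Set.Ioi 0) := by
    apply MeasureTheory.Integrable.of_integral_ne_zero
    rw [hval]
    positivity
  refine Real.tsum_le_of_sum_range_le (fun n => by positivity) fun N => ?_
  have hterm (n : ℕ) : ((n : ℝ) + 1) ^ m * Real.exp (-a * ((n : ℝ) + 1)) ≤
      Real.exp a * ∫ x in ((n : ℝ) + 1)..(((n + 1 : ℕ) : ℝ) + 1),
        x ^ m * Real.exp (-a * x) := by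
    have hle : ((n : ℝ) + 1) ≤ ((n + 1 : ℕ) : ℝ) + 1 := by push_cast; linarith
    have hmono := intervalIntegral.integral_mono_on
      (f := fun _ => ((n : ℝ) + 1) ^ m * Real.exp (-a * ((n : ℝ) + 1 + 1)))
      (g := fun x : ℝ => x ^ m * Real.exp (-a * x)) hle
      intervalIntegrable_const (hcont.intervalIntegrable (μ := MeasureTheory.volume) _ _)
      (fun x hx => by
        have h1 := hx.1
        have h2 := hx.2
        push_cast at h2
        refine mul_le_mul (pow_le_pow_left₀ (by positivity) h1 m) (Real.exp_le_exp.2 ?_)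
          (by positivity) (pow_nonneg (le_trans (by positivity) h1) m)
        nlinarith)
    rw [intervalIntegral.integral_const] at hmono
    have heq : ((n + 1 : ℕ) : ℝ) + 1 - ((n : ℝ) + 1) = 1 := by push_cast; ring
    rw [heq, one_smul] at hmono
    calc ((n : ℝ) + 1) ^ m * Real.exp (-a * ((n : ℝ) + 1))
        = Real.exp a * (((n : ℝ) + 1) ^ m * Real.exp (-a * ((n : ℝ) + 1 + 1))) := by
          rw [mul_left_comm, ← Real.exp_add]
          ring_nf
      _ ≤ _ := by gcongr
  have hadj := intervalIntegral.sum_integral_adjacent_intervals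
    (f := fun x : ℝ => x ^ m * Real.exp (-a * x)) (μ := MeasureTheory.volume)
    (a := fun n : ℕ => (n : ℝ) + 1) (n := N) (fun k _ => hcont.intervalIntegrable _ _)
  calc _ ≤ ∑ n ∈ Finset.range N, Real.exp a * ∫ x in ((n : ℝ) + 1)..(((n + 1 : ℕ) : ℝ) + 1),
        x ^ m * Real.exp (-a * x) := Finset.sum_le_sum fun n _ => hterm n
    _ = Real.exp a * ∫ x in (((0 : ℕ) : ℝ) + 1)..((N : ℝ) + 1), x ^ m * Real.exp (-a * x) := by
        rw [← Finset.mul_sum, hadj]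
    _ ≤ Real.exp a * ∫ x in Set.Ioi (0 : ℝ), x ^ m * Real.exp (-a * x) := by
        gcongr
        rw [intervalIntegral.integral_of_le (by simp)]
        refine MeasureTheory.setIntegral_mono_set hint ?_ ?_
        · filter_upwards [MeasureTheory.self_mem_ae_restrict measurableSet_Ioi] with x hx
          have : (0 : ℝ) < x := hx
          simp only [Pi.zero_apply]
          positivity
        · refine Eventually.of_forall fun x hx => ?_
          have := hx.1
          simp only [Nat.cast_zero, zero_add] at this
          exact lt_trans one_pos this
    _ = _ := by rw [hval]

theorem prod_range_add_mul_Gamma {x : ℝ} (hx : 0 < x) (n : ℕ) :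
    (∏ j ∈ Finset.range n, (x + j)) * Real.Gamma x = Real.Gamma (x + n) := by
  induction n with
  | zero => simp
  | succ n ih =>
    rw [Finset.prod_range_succ, mul_right_comm, ih, Nat.cast_add_one, ← add_assoc,
      Real.Gamma_add_one (by positivity), mul_comm]

theorem Gamma_mul_GammaSeq {x : ℝ} (hx : 0 < x) (n : ℕ) :
    (x + n) * Real.Gamma (x + n) * Real.GammaSeq x n =
      (n : ℝ) ^ x * n.factorial * Real.Gamma x := by
  have hprod : ∏ j ∈ Finset.range (n + 1), (x + j) ≠ 0 :=
    Finset.prod_ne_zero_iff.2 fun j _ => by positivity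
  have h := prod_range_add_mul_Gamma hx (n + 1)
  rw [Nat.cast_add_one, ← add_assoc, Real.Gamma_add_one (by positivity)] at h
  rw [← h, Real.GammaSeq]
  field_simp

/-- Gamma ratio asymptotics: `Γ(x + k) / Γ(y + k) = O(k ^ (x - y))`. -/
theorem isBigO_Gamma_div_Gamma {x y : ℝ} (hx : 0 < x) (hy : 0 < y) :
    (fun k : ℕ => Real.Gamma (x + k) / Real.Gamma (y + k)) =O[atTop]
      fun k : ℕ => (k : ℝ) ^ (x - y) := by
  have hlim : Tendsto (fun k : ℕ => Real.GammaSeq y k / Real.GammaSeq x k) atTop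
      (nhds (Real.Gamma y / Real.Gamma x)) :=
    (Real.GammaSeq_tendsto_Gamma y).div (Real.GammaSeq_tendsto_Gamma x)
      (Real.Gamma_pos_of_pos hx).ne'
  have hlin : (fun k : ℕ => (y + k) / (x + k)) =O[atTop] fun _ => (1 : ℝ) := by
    refine IsBigO.of_bound (y / x + 1) (Eventually.of_forall fun k => ?_)
    rw [Real.norm_of_nonneg (by positivity), norm_one, mul_one, div_le_iff₀ (by positivity)]
    have h1 : y / x * x = y := by field_simp
    have h2 : 0 ≤ y / x * k := by positivity
    nlinarith
  have hO := ((hlin.mul (hlim.isBigO_one ℝ)).const_mul_left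
    (Real.Gamma x / Real.Gamma y)).mul (isBigO_refl (fun k : ℕ => (k : ℝ) ^ (x - y)) atTop)
  simp only [one_mul] at hO
  refine hO.congr' ?_ EventuallyEq.rfl
  filter_upwards [eventually_gt_atTop 0] with k hk
  have hk' : (0 : ℝ) < k := by exact_mod_cast hk
  have hGx := Real.Gamma_pos_of_pos hx
  have hGy := Real.Gamma_pos_of_pos hy
  have hGyk := Real.Gamma_pos_of_pos (show 0 < y + k by positivity)
  have hseq {z : ℝ} (hz : 0 < z) : 0 < Real.GammaSeq z k :=
    div_pos (by positivity) (Finset.prod_pos fun j _ => by positivity)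
  have hsx := hseq hx
  have hX : Real.Gamma (x + k) =
      (k : ℝ) ^ x * k.factorial * Real.Gamma x / ((x + k) * Real.GammaSeq x k) := by
    rw [eq_div_iff (by positivity), ← Gamma_mul_GammaSeq hx]
    ring
  have hsy := hseq hy
  have hY : Real.Gamma (y + k) =
      (k : ℝ) ^ y * k.factorial * Real.Gamma y / ((y + k) * Real.GammaSeq y k) := by
    rw [eq_div_iff (by positivity), ← Gamma_mul_GammaSeq hy]
    ring
  rw [hX, hY, Real.rpow_sub hk']
  field_simp

theorem factorial_two_mul_eq_Gamma (k : ℕ) :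
    ((2 * k).factorial : ℝ) = 4 ^ k * k.factorial * Real.Gamma (1 / 2 + k) / √Real.pi := by
  have h := Real.Gamma_mul_Gamma_add_half ((k : ℝ) + 1 / 2)
  have h1 : (k : ℝ) + 1 / 2 + 1 / 2 = k + 1 := by ring
  have h2 : 2 * ((k : ℝ) + 1 / 2) = ((2 * k : ℕ) : ℝ) + 1 := by push_cast; ring
  have h3 : (1 : ℝ) - (((2 * k : ℕ) : ℝ) + 1) = -((2 * k : ℕ) : ℝ) := by ring
  rw [h1, h2, h3, Real.Gamma_nat_eq_factorial, Real.Gamma_nat_eq_factorial,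
    Real.rpow_neg (by norm_num), Real.rpow_natCast, pow_mul] at h
  norm_num only at h
  have hpi : √Real.pi ≠ 0 := by positivity
  rw [eq_div_iff hpi, mul_assoc, mul_comm (k.factorial : ℝ), add_comm (1 / 2 : ℝ), h]
  field_simp

theorem late_terms_bigO (ν a b : ℝ) (hν : -(1/2) < ν) (ha : 0 < a) (hb : 0 < b)
    (hab : b < a ∨ a = b) :
    (fun k : ℕ => (b / 2) ^ (2 * k) * negOrderPolylog (2 * k) a /
        ((k.factorial : ℝ) * Real.Gamma (1 + ν + k)))
      =O[atTop] (fun k : ℕ => ((k : ℝ) ^ (-ν - 1/2) : ℝ) * (b / a) ^ (2 * k)) ∧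
    (b < a → Summable (fun k : ℕ =>
      |(-1 : ℝ) ^ k * (b / 2) ^ (2 * k) * negOrderPolylog (2 * k) a /
        ((k.factorial : ℝ) * Real.Gamma (1 + ν + k))|)) := by
  have hν' : 0 < 1 + ν := by linarith
  have hGpos (k : ℕ) : 0 < Real.Gamma (1 + ν + k) := Real.Gamma_pos_of_pos (by positivity)
  have hbound : (fun k : ℕ => (b / 2) ^ (2 * k) * negOrderPolylog (2 * k) a /
        ((k.factorial : ℝ) * Real.Gamma (1 + ν + k)))
      =O[atTop] (fun k : ℕ => ((k : ℝ) ^ (-ν - 1/2) : ℝ) * (b / a) ^ (2 * k)) := by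
    have hratio := (isBigO_Gamma_div_Gamma (x := 1 / 2) (by norm_num) hν').mul
      (isBigO_refl (fun k : ℕ => (b / a) ^ (2 * k)) atTop)
    rw [show (1 / 2 : ℝ) - (1 + ν) = -ν - 1 / 2 by ring] at hratio
    refine IsBigO.trans (IsBigO.of_bound (Real.exp a / (a * √Real.pi))
      (Eventually.of_forall fun k => ?_)) hratio
    have hG := hGpos k
    have hG' : 0 < Real.Gamma (1 / 2 + k) := Real.Gamma_pos_of_pos (by positivity)
    have hP := negOrderPolylog_nonneg (2 * k) a
    rw [Real.norm_of_nonneg (by positivity), Real.norm_of_nonneg (by positivity)]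
    calc _ ≤ (b / 2) ^ (2 * k) * (Real.exp a * ((2 * k).factorial / a ^ (2 * k + 1))) /
          ((k.factorial : ℝ) * Real.Gamma (1 + ν + k)) := by
          gcongr
          exact negOrderPolylog_le _ ha
      _ = _ := by
          have h4 : (2 : ℝ) ^ (2 * k) = 4 ^ k := by rw [pow_mul]; norm_num
          rw [factorial_two_mul_eq_Gamma, div_pow, div_pow, h4, pow_succ]
          field_simp
  refine ⟨hbound, fun hlt => ?_⟩
  have hr : (b / a) ^ 2 < 1 := pow_lt_one₀ (by positivity) ((div_lt_one ha).2 hlt) two_ne_zero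
  refine summable_of_isBigO_nat (summable_geometric_of_lt_one (by positivity) hr) ?_
  have hgeom : (fun k : ℕ => ((k : ℝ) ^ (-ν - 1/2) : ℝ) * (b / a) ^ (2 * k)) =O[atTop]
      fun k : ℕ => ((b / a) ^ 2) ^ k := by
    refine IsBigO.of_bound 1 ?_
    filter_upwards [eventually_ge_atTop 1] with k hk
    have hk' : (1 : ℝ) ≤ k := by exact_mod_cast hk
    rw [Real.norm_of_nonneg (by positivity), Real.norm_of_nonneg (by positivity), ← pow_mul]
    gcongr
    exact Real.rpow_le_one_of_one_le_of_nonpos hk' (by linarith)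
  refine (hbound.trans hgeom).norm_left.congr_left fun k => ?_
  rw [Real.norm_eq_abs, mul_assoc, mul_div_assoc ((-1 : ℝ) ^ k), abs_mul, abs_pow, abs_neg,
    abs_one, one_pow, one_mul]
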